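/- arXiv:2503.09664 — 2 statements merged into one kernel-verified Lean document; each statement's English description precedes it below -/
import Mathlib

section
/- Fix a real number q > 1 and an integer n ≥ 1. For every triple (n₁, n₂, n₃) of nonnegative integers with n₁ + n₂ + n₃ = n let c_{(n₁,n₂,n₃)} be a real constant, and define F(x) := Σ_{(n₁,n₂,n₃)} c_{(n₁,n₂,n₃)} · q^{n₃(n₁+n₂)·x} · vol_{n₂, n₁−n₃}(x) for integers x ≥ 0. Then F admits a q-quasi-polynomial expansion with coefficients c such that c(0,1) = c_{(0,n,0)} · B_n, where B_n := n · ∏_{i=1}^{n−1} (1 − q^{i})^{−1} is nonzero. In particular, if F(x) = 0 for all sufficiently large integers x, then c_{(0,n,0)} = 0. -/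
open Finset

noncomputable section

/-- `μ_m := ∏_{i=1}^{m} (1 − q⁻¹)/(1 − q^{-i})`. -/
def mu (q : ℝ) (m : ℕ) : ℝ :=
  ∏ i ∈ Finset.range m, (1 - q⁻¹) / (1 - q ^ (-((i : ℤ) + 1)))

/-- For a weakly increasing tuple `λ`, the product `∏_j μ_{n_j}` over the lengths
`(n_1, …, n_s)` of the maximal constant segments of `λ` (equivalently, over the
cardinalities of the fibers of `λ`). -/
def typeProd (q : ℝ) {n : ℕ} (l : Fin n → ℤ) : ℝ :=
  ∏ v ∈ Finset.image l Finset.univ, mu q ((Finset.univ.filter fun i => l i = v).card)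

/-- The weight `w_n(λ) := ((∏_j μ_{n_j})/μ_n) · ∏_{i<j} q^{λ_j − λ_i}`. -/
def weight (q : ℝ) {n : ℕ} (l : Fin n → ℤ) : ℝ :=
  (typeProd q l / mu q n) *
    ∏ p ∈ Finset.univ.filter (fun p : Fin n × Fin n => p.1 < p.2), q ^ (l p.2 - l p.1)

open scoped Classical in
/-- The weakly increasing integer tuples `0 ≤ λ_1 ≤ ⋯ ≤ λ_n ≤ x`. -/
def tuples (n x : ℕ) : Finset (Fin n → ℤ) :=
  (Fintype.piFinset fun _ : Fin n => Finset.Icc (0 : ℤ) (x : ℤ)).filter Monotone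

/-- `vol_{n,α}(x) := Σ_{0 ≤ λ_1 ≤ ⋯ ≤ λ_n ≤ x} q^{α(λ_1+⋯+λ_n)} · w_n(λ)`
(for `n = 0` this is `1` by convention, the sum being over the single empty tuple). -/
def vol (q : ℝ) (n : ℕ) (α : ℤ) (x : ℕ) : ℝ :=
  ∑ l ∈ tuples n x, q ^ (α * ∑ i, l i) * weight q l

/-- The Gaussian binomial coefficient `∏_{i=1}^{β} (q^{n−β+i} − 1)/(q^{i} − 1)`. -/
def gaussBinom (q : ℝ) (n β : ℕ) : ℝ :=
  ∏ i ∈ Finset.range β, (q ^ (n - β + i + 1) - 1) / (q ^ (i + 1) - 1)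

/-- Evaluation of a finitely supported family of coefficients `c : ℕ × ℕ → ℝ` as the
`q`-quasi-polynomial `x ↦ Σ_{(a,b)} c(a,b) · q^{a·x} · x^{b}`. -/
def qQuasiEval (q : ℝ) (c : (ℕ × ℕ) →₀ ℝ) (x : ℕ) : ℝ :=
  c.sum fun p r => r * q ^ (p.1 * x) * (x : ℝ) ^ p.2

end

noncomputable section

/-- `B_n := n · ∏_{i=1}^{n−1} (1 − q^{i})⁻¹`. -/
def Bn (q : ℝ) (n : ℕ) : ℝ := (n : ℝ) * ∏ i ∈ Finset.Ico 1 n, (1 - q ^ i)⁻¹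

/-- Triples `(n₁, n₂, n₃)` of nonnegative integers with `n₁ + n₂ + n₃ = n`. -/
def triples (n : ℕ) : Finset (ℕ × ℕ × ℕ) :=
  (Finset.range (n + 1) ×ˢ Finset.range (n + 1) ×ˢ Finset.range (n + 1)).filter
    fun t => t.1 + t.2.1 + t.2.2 = n

/-- `F(x) := Σ_{(n₁,n₂,n₃)} c_{(n₁,n₂,n₃)} · q^{n₃(n₁+n₂)x} · vol_{n₂, n₁−n₃}(x)`. -/
def germComb (q : ℝ) (n : ℕ) (c : ℕ × ℕ × ℕ → ℝ) (x : ℕ) : ℝ :=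
  ∑ t ∈ triples n,
    c t * q ^ (t.2.2 * (t.1 + t.2.1) * x) * vol q t.2.1 ((t.1 : ℤ) - (t.2.2 : ℤ)) x

end


/-- `(q; q)_k = ∏_{i=1}^k (1 - q^i)`. -/
def qP (q : ℝ) (k : ℕ) : ℝ := ∏ i ∈ Finset.range k, (1 - q ^ (i + 1))

/-- Gaussian binomial in the form `(q)_{i+j} / ((q)_i (q)_j)`. -/
noncomputable def qG (q : ℝ) (i j : ℕ) : ℝ := qP q (i + j) / (qP q i * qP q j)

lemma qP_zero (q : ℝ) : qP q 0 = 1 := by simp [qP]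

lemma qP_succ (q : ℝ) (k : ℕ) : qP q (k + 1) = qP q k * (1 - q ^ (k + 1)) := by
  simp [qP, Finset.prod_range_succ]

lemma one_sub_ne {q : ℝ} (hq : 1 < q) (k : ℕ) : (1 - q ^ (k + 1)) ≠ 0 := by
  have := one_lt_pow₀ hq (Nat.succ_ne_zero k)
  intro h
  simp only [Nat.succ_eq_add_one] at this
  linarith

lemma qP_ne {q : ℝ} (hq : 1 < q) (k : ℕ) : qP q k ≠ 0 :=
  Finset.prod_ne_zero_iff.mpr fun i _ => one_sub_ne hq i

lemma qG_zero_left {q : ℝ} (hq : 1 < q) (k : ℕ) : qG q 0 k = 1 := by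
  have := qP_ne hq k
  simp [qG, qP_zero, this]

lemma qG_left {q : ℝ} (hq : 1 < q) (i j : ℕ) :
    (1 - q ^ (i + 1)) * qG q (i + 1) j = (1 - q ^ (i + j + 1)) * qG q i j := by
  have h1 := qP_ne hq i
  have h2 := qP_ne hq j
  have h3 := one_sub_ne hq i
  unfold qG
  rw [show i + 1 + j = (i + j) + 1 by ring, qP_succ, qP_succ]
  field_simp

lemma qG_right {q : ℝ} (hq : 1 < q) (i j : ℕ) :
    (1 - q ^ (j + 1)) * qG q i (j + 1) = (1 - q ^ (i + j + 1)) * qG q i j := by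
  have h1 := qP_ne hq i
  have h2 := qP_ne hq j
  have h3 := one_sub_ne hq j
  unfold qG
  rw [show i + (j + 1) = (i + j) + 1 by ring, qP_succ, qP_succ]
  field_simp

lemma sum_qG_left {q : ℝ} (hq : 1 < q) (k : ℕ) (h : ℕ → ℕ → ℝ) :
    ∑ p ∈ antidiagonal (k + 1), (1 - q ^ p.1) * qG q p.1 p.2 * h p.1 p.2 =
      (1 - q ^ (k + 1)) * ∑ p ∈ antidiagonal k, qG q p.1 p.2 * h (p.1 + 1) p.2 := by
  rw [Finset.Nat.sum_antidiagonal_succ, Finset.mul_sum]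
  simp only [pow_zero, sub_self, zero_mul, zero_add]
  refine Finset.sum_congr rfl fun p hp => ?_
  rw [Finset.HasAntidiagonal.mem_antidiagonal] at hp
  rw [qG_left hq, hp]
  ring

lemma sum_qG_right {q : ℝ} (hq : 1 < q) (k : ℕ) (h : ℕ → ℕ → ℝ) :
    ∑ p ∈ antidiagonal (k + 1), (1 - q ^ p.2) * qG q p.1 p.2 * h p.1 p.2 =
      (1 - q ^ (k + 1)) * ∑ p ∈ antidiagonal k, qG q p.1 p.2 * h p.1 (p.2 + 1) := by
  rw [Finset.Nat.sum_antidiagonal_succ', Finset.mul_sum]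
  simp only [pow_zero, sub_self, zero_mul, zero_add]
  refine Finset.sum_congr rfl fun p hp => ?_
  rw [Finset.HasAntidiagonal.mem_antidiagonal] at hp
  rw [qG_right hq, hp]
  ring

lemma pascal1 {q : ℝ} (hq : 1 < q) (k : ℕ) (h : ℕ → ℕ → ℝ) :
    ∑ p ∈ antidiagonal (k + 1), qG q p.1 p.2 * h p.1 p.2 =
      ∑ p ∈ antidiagonal k, qG q p.1 p.2 * (q ^ p.1 * h p.1 (p.2 + 1) + h (p.1 + 1) p.2) := by
  apply mul_left_cancel₀ (one_sub_ne hq k)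
  have e1 := sum_qG_left hq k h
  have e2 := sum_qG_right hq k (fun i j => q ^ i * h i j)
  simp only [mul_add, Finset.sum_add_distrib]
  rw [← e1, ← e2, ← Finset.sum_add_distrib, Finset.mul_sum]
  refine Finset.sum_congr rfl fun p hp => ?_
  rw [Finset.HasAntidiagonal.mem_antidiagonal] at hp
  rw [← hp, pow_add]
  ring

lemma pascal2 {q : ℝ} (hq : 1 < q) (k : ℕ) (h : ℕ → ℕ → ℝ) :
    ∑ p ∈ antidiagonal (k + 1), qG q p.1 p.2 * h p.1 p.2 =
      ∑ p ∈ antidiagonal k, qG q p.1 p.2 * (h p.1 (p.2 + 1) + q ^ p.2 * h (p.1 + 1) p.2) := by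
  apply mul_left_cancel₀ (one_sub_ne hq k)
  have e1 := sum_qG_left hq k (fun i j => q ^ j * h i j)
  have e2 := sum_qG_right hq k h
  simp only [mul_add, Finset.sum_add_distrib]
  rw [← e1, ← e2, ← Finset.sum_add_distrib, Finset.mul_sum]
  refine Finset.sum_congr rfl fun p hp => ?_
  rw [Finset.HasAntidiagonal.mem_antidiagonal] at hp
  rw [← hp, pow_add]
  ring

lemma qident1 {q : ℝ} (hq : 1 < q) (r k : ℕ) :
    ∑ p ∈ antidiagonal k, qG q p.1 p.2 * (qP q (r + p.1) * q ^ ((r + 1) * p.2)) = qP q r := by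
  induction k with
  | zero => simp [qG_zero_left hq]
  | succ k ih =>
    rw [pascal1 hq k (fun i j => qP q (r + i) * q ^ ((r + 1) * j)), ← ih]
    refine Finset.sum_congr rfl fun p _ => ?_
    rw [← add_assoc, qP_succ]
    ring

lemma qident2 {q : ℝ} (hq : 1 < q) (n : ℕ) :
    ∑ p ∈ antidiagonal n, qG q p.1 p.2 * (if p.1 = 0 then 0 else qP q (p.1 - 1)) = n := by
  induction n with
  | zero => simp
  | succ n ih =>
    rw [pascal2 hq n (fun i _ => if i = 0 then 0 else qP q (i - 1))]
    simp only [mul_add, Finset.sum_add_distrib]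
    rw [ih]
    have := qident1 hq 0 n
    rw [qP_zero] at this
    push_cast
    rw [← this]
    congr 1
    refine Finset.sum_congr rfl fun p _ => ?_
    rw [zero_add, zero_add, one_mul]
    ring

lemma mu_eq {q : ℝ} (hq : 1 < q) (m : ℕ) :
    mu q m * qP q m = (q⁻¹ - 1) ^ m * q ^ (∑ i ∈ Finset.range m, (i + 1)) := by
  induction m with
  | zero => simp [mu, qP]
  | succ m ih =>
    have h0 : q ≠ 0 := by positivity
    have h1 := one_sub_ne hq m
    have : mu q (m + 1) = mu q m * ((1 - q⁻¹) / (1 - q ^ (-((m : ℤ) + 1)))) := by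
      exact Finset.prod_range_succ _ _
    rw [this, qP_succ, Finset.sum_range_succ, pow_succ (q⁻¹ - 1), pow_add q (∑ i ∈ Finset.range m, (i + 1)), show mu q m * ((1 - q⁻¹) / (1 - q ^ (-((m : ℤ) + 1)))) * (qP q m * (1 - q ^ (m + 1))) = (mu q m * qP q m) * ((1 - q⁻¹) / (1 - q ^ (-((m : ℤ) + 1))) * (1 - q ^ (m + 1))) by ring, ih]
    have h2 : (1 - q⁻¹) / (1 - q ^ (-((m : ℤ) + 1))) * (1 - q ^ (m + 1)) =
        (q⁻¹ - 1) * q ^ (m + 1) := by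
      have e : q ^ (-((m : ℤ) + 1)) = (q ^ (m + 1))⁻¹ := by
        rw [zpow_neg]; norm_cast
      rw [e]
      have h3 : q ^ (m + 1) ≠ 0 := by positivity
      have h4 : 1 - (q ^ (m + 1))⁻¹ ≠ 0 := by
        intro h
        apply h1
        field_simp at h
        linarith
      rw [div_mul_eq_mul_div, div_eq_iff h4]
      field_simp
      ring
    rw [h2]
    ring

lemma mu_ne {q : ℝ} (hq : 1 < q) (m : ℕ) : mu q m ≠ 0 := by
  intro h
  have := mu_eq hq m
  rw [h, zero_mul] at this
  have h0 : q ≠ 0 := by positivity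
  have h1 : q⁻¹ - 1 ≠ 0 := by
    have := inv_lt_one_of_one_lt₀ hq
    intro h; linarith
  exact mul_ne_zero (pow_ne_zero _ h1) (pow_ne_zero _ h0) this.symm

lemma mu_qG {q : ℝ} (hq : 1 < q) (m k : ℕ) :
    mu q m * mu q k / mu q (m + k) * q ^ (m * k) = qG q m k := by
  have h0 : q ≠ 0 := by positivity
  have h1 : q⁻¹ - 1 ≠ 0 := by
    have := inv_lt_one_of_one_lt₀ hq
    intro h; linarith
  have hs : ∑ i ∈ Finset.range (m + k), (i + 1) =
      ∑ i ∈ Finset.range m, (i + 1) + ∑ i ∈ Finset.range k, (i + 1) + m * k := by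
    rw [Finset.sum_range_add]
    simp only [add_assoc, Finset.sum_add_distrib, Finset.sum_const, Finset.card_range, smul_eq_mul]
    ring
  have em := mu_eq hq m
  have ek := mu_eq hq k
  have emk := mu_eq hq (m + k)
  rw [hs, pow_add, pow_add, pow_add] at emk
  have n1 := qP_ne hq m
  have n2 := qP_ne hq k
  have n3 := mu_ne hq (m + k)
  unfold qG
  rw [div_mul_eq_mul_div, div_eq_div_iff n3 (mul_ne_zero n1 n2)]
  calc mu q m * mu q k * q ^ (m * k) * (qP q m * qP q k)
      = (mu q m * qP q m) * (mu q k * qP q k) * q ^ (m * k) := by ring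
    _ = mu q (m + k) * qP q (m + k) := by rw [em, ek, emk]; ring
    _ = _ := by ring

/-- prepend `m` zeros to the shifted tuple `l + 1` -/
def prep (m : ℕ) {k : ℕ} (l : Fin k → ℤ) : Fin (m + k) → ℤ :=
  Fin.append (fun _ : Fin m => (0 : ℤ)) (fun i => l i + 1)

lemma prep_left (m : ℕ) {k : ℕ} (l : Fin k → ℤ) (i : Fin m) : prep m l (Fin.castAdd k i) = 0 := by
  simp [prep]

lemma prep_right (m : ℕ) {k : ℕ} (l : Fin k → ℤ) (i : Fin k) :
    prep m l (Fin.natAdd m i) = l i + 1 := by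
  simp [prep]

lemma mem_tuples {n x : ℕ} {l : Fin n → ℤ} :
    l ∈ tuples n x ↔ (∀ i, 0 ≤ l i ∧ l i ≤ x) ∧ Monotone l := by
  classical
  simp [tuples]

lemma prep_sum (m : ℕ) {k : ℕ} (l : Fin k → ℤ) : ∑ i, prep m l i = ∑ i, l i + k := by
  rw [Fin.sum_univ_add]
  simp [prep_left, prep_right, Finset.sum_add_distrib]

lemma prep_pairs {q : ℝ} (hq : 1 < q) (m : ℕ) {k : ℕ} (l : Fin k → ℤ) :
    ∏ p ∈ Finset.univ.filter (fun p : Fin (m + k) × Fin (m + k) => p.1 < p.2),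
      q ^ (prep m l p.2 - prep m l p.1) =
    q ^ ((m : ℤ) * (∑ i, l i)) * q ^ (m * k) *
      ∏ p ∈ Finset.univ.filter (fun p : Fin k × Fin k => p.1 < p.2), q ^ (l p.2 - l p.1) := by
  have h0 : q ≠ 0 := by positivity
  simp only [Finset.prod_filter, Fintype.prod_prod_type]
  rw [Fin.prod_univ_add]
  simp only [Fin.prod_univ_add, prep_left, prep_right]
  have e1 : ∀ (i : Fin m) (j : Fin k), Fin.castAdd k i < Fin.natAdd m j := by
    intro i j
    simp [Fin.lt_def]; omega
  have e2 : ∀ (i : Fin m) (j : Fin k), ¬ Fin.natAdd m j < Fin.castAdd k i := by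
    intro i j
    simp [Fin.lt_def]; omega
  have e3 : ∀ (i j : Fin k), Fin.natAdd m j < Fin.natAdd m i ↔ j < i := by
    intro i j
    simp
  simp only [e1, e2, e3, if_true, if_false, sub_self, zpow_zero, ite_self, Finset.prod_const_one,
    one_mul, sub_zero, add_sub_add_right_eq_sub]
  congr 1
  have e4 : ∀ s : Finset (Fin k), ∏ x ∈ s, q ^ (l x + 1) = q ^ (∑ x ∈ s, (l x + 1)) := by
    intro s
    induction s using Finset.induction_on with
    | empty => simp
    | insert a s ha ih => rw [Finset.prod_insert ha, Finset.sum_insert ha, zpow_add₀ h0 (l a + 1), ih]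
  rw [e4]
  simp only [Finset.prod_const, Finset.card_univ, Fintype.card_fin, Finset.sum_add_distrib,
    Finset.sum_const, nsmul_eq_mul, mul_one]
  rw [← zpow_natCast, ← zpow_mul, ← zpow_natCast q (m * k), ← zpow_add₀ h0]
  congr 1
  push_cast
  ring

lemma mu_zero (q : ℝ) : mu q 0 = 1 := by simp [mu]

lemma typeProd_eq (q : ℝ) {n : ℕ} (l : Fin n → ℤ) (S : Finset ℤ) (hS : ∀ i, l i ∈ S) :
    typeProd q l = ∏ v ∈ S, mu q ((Finset.univ.filter fun i => l i = v).card) := by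
  unfold typeProd
  apply Finset.prod_subset
  · intro v hv
    obtain ⟨i, _, rfl⟩ := Finset.mem_image.mp hv
    exact hS i
  · intro v _ hv
    have : (Finset.univ.filter fun i => l i = v) = ∅ := by
      rw [Finset.filter_eq_empty_iff]
      intro i _ h
      exact hv (Finset.mem_image.mpr ⟨i, Finset.mem_univ _, h⟩)
    rw [this, Finset.card_empty, mu_zero]

lemma card_prep (m : ℕ) {k : ℕ} (l : Fin k → ℤ) (v : ℤ) :
    (Finset.univ.filter fun i => prep m l i = v).card =
      (if v = 0 then m else 0) + (Finset.univ.filter fun i => l i + 1 = v).card := by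
  simp only [Finset.card_filter]
  rw [Fin.sum_univ_add]
  simp only [prep_left, prep_right]
  congr 1
  by_cases h : v = 0
  · simp [h]
  · simp [h, Ne.symm h]

lemma prep_typeProd (q : ℝ) (m x : ℕ) {k : ℕ} (l : Fin k → ℤ) (hl : l ∈ tuples k x) :
    typeProd q (prep m l) = mu q m * typeProd q l := by
  rw [mem_tuples] at hl
  have hz : (0 : ℤ) ∉ (Finset.univ.image l).image (fun v => v + 1) := by
    simp only [Finset.mem_image, not_exists, not_and]
    rintro a ⟨i, _, rfl⟩ h
    have := (hl.1 i).1
    omega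
  rw [typeProd_eq q (prep m l) (insert 0 ((Finset.univ.image l).image (fun v => v + 1)))]
  · rw [Finset.prod_insert hz, Finset.prod_image (by intro a _ b _ h; simpa using h)]
    congr 1
    · rw [card_prep]
      have : (Finset.univ.filter fun i => l i + 1 = 0) = ∅ := by
        rw [Finset.filter_eq_empty_iff]
        intro i _ h
        have := (hl.1 i).1
        omega
      rw [this]
      simp
    · unfold typeProd
      refine Finset.prod_congr rfl fun v hv => ?_
      obtain ⟨i, _, rfl⟩ := Finset.mem_image.mp hv
      rw [card_prep]
      have : l i + 1 ≠ 0 := by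
        have := (hl.1 i).1
        omega
      simp [this]
  · intro i
    refine Fin.addCases (fun i => ?_) (fun i => ?_) i
    · rw [prep_left]; simp
    · rw [prep_right]
      apply Finset.mem_insert_of_mem
      exact Finset.mem_image_of_mem _ (Finset.mem_image_of_mem _ (Finset.mem_univ _))

lemma prep_term {q : ℝ} (hq : 1 < q) (α : ℤ) (m x : ℕ) {k : ℕ} (l : Fin k → ℤ)
    (hl : l ∈ tuples k x) :
    q ^ (α * ∑ i, prep m l i) * weight q (prep m l) =
      qG q m k * q ^ (α * k) * (q ^ ((α + m) * ∑ i, l i) * weight q l) := by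
  have h0 : q ≠ 0 := by positivity
  unfold weight
  rw [prep_pairs hq, prep_typeProd q m x l hl, prep_sum, ← mu_qG hq, mul_add α, zpow_add₀ h0,
    add_mul α, zpow_add₀ h0]
  have h1 := mu_ne hq k
  have h2 := mu_ne hq (m + k)
  field_simp

lemma prep_mem {m x k : ℕ} {l : Fin k → ℤ} (hl : l ∈ tuples k x) :
    prep m l ∈ tuples (m + k) (x + 1) := by
  rw [mem_tuples] at hl ⊢
  constructor
  · intro i
    refine Fin.addCases (fun i => ?_) (fun i => ?_) i
    · rw [prep_left]; exact ⟨le_rfl, by positivity⟩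
    · rw [prep_right]
      have := hl.1 i
      push_cast; omega
  · intro i j
    refine Fin.addCases (fun i => ?_) (fun i => ?_) i <;>
      refine Fin.addCases (fun j => ?_) (fun j => ?_) j
    · simp [prep_left]
    · intro _
      rw [prep_left, prep_right]
      have := hl.1 j
      omega
    · intro h
      simp [Fin.le_def] at h
      omega
    · intro h
      rw [prep_right, prep_right]
      have := hl.2 (show i ≤ j by simpa using h)
      omega

lemma prep_card {m x k : ℕ} {l : Fin k → ℤ} (hl : l ∈ tuples k x) :
    (Finset.univ.filter fun i => prep m l i = 0).card = m := by
  rw [mem_tuples] at hl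
  rw [card_prep]
  have : (Finset.univ.filter fun i => l i + 1 = 0) = ∅ := by
    rw [Finset.filter_eq_empty_iff]
    intro i _ h
    have := (hl.1 i).1
    omega
  rw [this]
  simp

lemma prep_surj {m x k : ℕ} {l : Fin (m + k) → ℤ} (hl : l ∈ tuples (m + k) (x + 1))
    (hc : (Finset.univ.filter fun i => l i = 0).card = m) :
    ∃ l' ∈ tuples k x, prep m l' = l := by
  rw [mem_tuples] at hl
  have key : ∀ i, l i = 0 ↔ i.1 < m := by
    intro i
    constructor
    · intro hi
      by_contra hlt
      have hsub : Finset.Iic i ⊆ (Finset.univ.filter fun i => l i = 0) := by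
        intro j hj
        have := hl.2 (Finset.mem_Iic.mp hj)
        have := (hl.1 j).1
        simp only [Finset.mem_filter, Finset.mem_univ, true_and]
        omega
      have := Finset.card_le_card hsub
      rw [hc, Fin.card_Iic] at this
      omega
    · intro hi
      by_contra hne
      have hsub : (Finset.univ.filter fun i => l i = 0) ⊆ Finset.Iio i := by
        intro j hj
        simp only [Finset.mem_filter, Finset.mem_univ, true_and] at hj
        rw [Finset.mem_Iio]
        by_contra hji
        have := hl.2 (not_lt.mp hji)
        have := (hl.1 i).1
        omega
      have := Finset.card_le_card hsub
      rw [hc, Fin.card_Iio] at this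
      omega
  refine ⟨fun i => l (Fin.natAdd m i) - 1, ?_, ?_⟩
  · rw [mem_tuples]
    constructor
    · intro i
      have h1 := hl.1 (Fin.natAdd m i)
      have h2 := (key (Fin.natAdd m i)).not.mpr (by simp)
      push_cast at h1
      omega
    · intro i j h
      have := hl.2 (show Fin.natAdd m i ≤ Fin.natAdd m j by simpa using h)
      simp only
      omega
  · funext i
    refine Fin.addCases (fun i => ?_) (fun i => ?_) i
    · rw [prep_left]
      exact ((key _).mpr (by simp)).symm
    · rw [prep_right]
      ring

lemma prep_inj {m k : ℕ} {l l' : Fin k → ℤ} (h : prep m l = prep m l') : l = l' := by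
  funext i
  have := congrFun h (Fin.natAdd m i)
  rw [prep_right, prep_right] at this
  omega

lemma vol_succ {q : ℝ} (hq : 1 < q) (n : ℕ) (α : ℤ) (x : ℕ) :
    vol q n α (x + 1) =
      ∑ p ∈ antidiagonal n, qG q p.1 p.2 * q ^ (α * p.2) * vol q p.2 (α + p.1) x := by
  unfold vol
  have hmaps : ∀ l ∈ tuples n (x + 1),
      ((Finset.univ.filter fun i => l i = 0).card,
        n - (Finset.univ.filter fun i => l i = 0).card) ∈ antidiagonal n := by
    intro l _
    have : (Finset.univ.filter fun i => l i = 0).card ≤ n := by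
      simpa using Finset.card_le_univ (Finset.univ.filter fun i => l i = 0)
    rw [Finset.HasAntidiagonal.mem_antidiagonal]
    simp only
    omega
  rw [← Finset.sum_fiberwise_of_maps_to hmaps]
  refine Finset.sum_congr rfl fun p hp => ?_
  obtain ⟨m, k⟩ := p
  rw [Finset.HasAntidiagonal.mem_antidiagonal] at hp
  simp only at hp
  subst hp
  rw [Finset.mul_sum]
  symm
  refine Finset.sum_bij (fun l _ => prep m l) ?_ ?_ ?_ ?_
  · intro l hl
    rw [Finset.mem_filter]
    refine ⟨prep_mem hl, ?_⟩
    rw [prep_card hl]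
    simp
  · intro l _ l' _ h
    exact prep_inj h
  · intro l hl
    rw [Finset.mem_filter] at hl
    obtain ⟨l', h1, h2⟩ := prep_surj hl.1 (congrArg Prod.fst hl.2)
    exact ⟨l', h1, h2⟩
  · intro l hl
    exact (prep_term hq α m x l hl).symm

lemma vol_zero_x {q : ℝ} (hq : 1 < q) (n : ℕ) (α : ℤ) : vol q n α 0 = 1 := by
  have ht : tuples n 0 = {fun _ => 0} := by
    ext l
    rw [mem_tuples, Finset.mem_singleton]
    constructor
    · intro h
      funext i
      have := h.1 i
      push_cast at this
      omega
    · rintro rfl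
      exact ⟨by simp, monotone_const⟩
  unfold vol
  rw [ht, Finset.sum_singleton]
  unfold weight
  rw [typeProd_eq q _ {0} (by simp)]
  simp [mu_ne hq n]

lemma vol_zero_n (q : ℝ) (α : ℤ) (x : ℕ) : vol q 0 α x = 1 := by
  have ht : tuples 0 x = Finset.univ := by
    ext l
    rw [mem_tuples]
    exact ⟨fun _ => Finset.mem_univ _, fun _ => ⟨fun i => i.elim0, Subsingleton.monotone l⟩⟩
  unfold vol
  rw [ht]
  simp [weight, typeProd, mu_zero]

/-- the basis function `q^{ax} x^b` -/
def qB (q : ℝ) (a b : ℕ) : ℕ → ℝ := fun x => q ^ (a * x) * (x : ℝ) ^ b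

/-- span of the `q^{ax} x^b` with `a ≠ 0` or `b < m` -/
def qS (q : ℝ) (m : ℕ) : Submodule ℝ (ℕ → ℝ) :=
  Submodule.span ℝ {f | ∃ a b : ℕ, (a ≠ 0 ∨ b < m) ∧ f = qB q a b}

lemma qB_mem (q : ℝ) {m a b : ℕ} (h : a ≠ 0 ∨ b < m) : qB q a b ∈ qS q m :=
  Submodule.subset_span ⟨a, b, h, rfl⟩

lemma qS_mono (q : ℝ) {m m' : ℕ} (h : m ≤ m') : qS q m ≤ qS q m' := by
  apply Submodule.span_mono
  rintro f ⟨a, b, h1, rfl⟩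
  exact ⟨a, b, by omega, rfl⟩

/-- the operator `h ↦ h(x+1) - q^a h(x)` -/
def qD (q : ℝ) (a : ℕ) : (ℕ → ℝ) →ₗ[ℝ] (ℕ → ℝ) where
  toFun h := fun x => h (x + 1) - q ^ a * h x
  map_add' f g := by
    funext x
    simp only [Pi.add_apply]
    ring
  map_smul' c f := by
    funext x
    simp only [Pi.smul_apply, smul_eq_mul, RingHom.id_apply]
    ring

lemma qD_qB (q : ℝ) (a a' b : ℕ) :
    qD q a (qB q a' b) = (q ^ a' - q ^ a) • qB q a' b +
      ∑ i ∈ Finset.range b, (q ^ a' * (b.choose i : ℝ)) • qB q a' i := by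
  funext x
  simp only [qD, qB, LinearMap.coe_mk, AddHom.coe_mk, Pi.add_apply, Pi.smul_apply, smul_eq_mul,
    Finset.sum_apply]
  push_cast
  rw [add_pow, Finset.sum_range_succ]
  simp only [one_pow, mul_one, Nat.choose_self, Nat.cast_one]
  have : ∑ i ∈ Finset.range b, q ^ a' * (b.choose i : ℝ) * (q ^ (a' * x) * (x : ℝ) ^ i) =
      q ^ a' * q ^ (a' * x) * ∑ i ∈ Finset.range b, (x : ℝ) ^ i * (b.choose i : ℝ) := by
    rw [Finset.mul_sum]
    exact Finset.sum_congr rfl fun i _ => by ring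
  rw [this, mul_add a' x 1, pow_add, mul_one]
  ring

lemma qD_solve_basis {q : ℝ} (hq : 1 < q) (a m m' a' : ℕ)
    (hm : m ≤ m') (ha : a = 0 → m + 1 ≤ m') (b : ℕ) (hb : a' ≠ 0 ∨ b < m) :
    qB q a' b ∈ (qS q m').map (qD q a) := by
  have hinj : ∀ i j : ℕ, q ^ i = q ^ j → i = j := fun i j h => pow_right_injective₀ (by linarith) hq.ne' h
  induction b using Nat.strong_induction_on with
  | _ b ih =>
    by_cases h : a' = a
    · subst h
      have e := qD_qB q a' a' (b + 1)
      rw [sub_self, zero_smul, zero_add, Finset.sum_range_succ] at e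
      have hc : q ^ a' * ((b + 1).choose b : ℝ) ≠ 0 := by
        rw [Nat.choose_succ_self_right]
        positivity
      have h1 : (q ^ a' * ((b + 1).choose b : ℝ)) • qB q a' b ∈ (qS q m').map (qD q a') := by
        rw [show (q ^ a' * ((b + 1).choose b : ℝ)) • qB q a' b = qD q a' (qB q a' (b + 1)) -
          ∑ i ∈ Finset.range b, (q ^ a' * ((b + 1).choose i : ℝ)) • qB q a' i by rw [e]; abel]
        apply Submodule.sub_mem
        · apply Submodule.mem_map_of_mem
          apply qB_mem
          by_cases h0 : a' = 0
          · right
            have := ha h0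
            omega
          · exact Or.inl h0
        · refine Submodule.sum_mem _ fun i hi => Submodule.smul_mem _ _ ?_
          have := Finset.mem_range.mp hi
          exact ih i this (by omega)
      exact (Submodule.smul_mem_iff _ hc).mp h1
    · have e := qD_qB q a a' b
      have hc : q ^ a' - q ^ a ≠ 0 := fun hh => h (hinj _ _ (by linarith))
      have h1 : (q ^ a' - q ^ a) • qB q a' b ∈ (qS q m').map (qD q a) := by
        rw [show (q ^ a' - q ^ a) • qB q a' b = qD q a (qB q a' b) -
          ∑ i ∈ Finset.range b, (q ^ a' * (b.choose i : ℝ)) • qB q a' i by rw [e]; abel]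
        apply Submodule.sub_mem
        · apply Submodule.mem_map_of_mem
          apply qB_mem
          omega
        · refine Submodule.sum_mem _ fun i hi => Submodule.smul_mem _ _ ?_
          have := Finset.mem_range.mp hi
          exact ih i this (by omega)
      exact (Submodule.smul_mem_iff _ hc).mp h1

lemma qD_solve {q : ℝ} (hq : 1 < q) (a m m' : ℕ)
    (hm : m ≤ m') (ha : a = 0 → m + 1 ≤ m') (f : ℕ → ℝ) (hf : qD q a f ∈ qS q m) :
    f ∈ qS q m' := by
  have hle : qS q m ≤ (qS q m').map (qD q a) := by
    apply Submodule.span_le.mpr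
    rintro g ⟨a', b, h, rfl⟩
    exact qD_solve_basis hq a m m' a' hm ha b h
  obtain ⟨h, h1, h2⟩ := Submodule.mem_map.mp (hle hf)
  have hz : ∀ x, (f - h) (x + 1) = q ^ a * (f - h) x := by
    intro x
    have := congrFun h2 x
    simp only [qD, LinearMap.coe_mk, AddHom.coe_mk] at this
    simp only [Pi.sub_apply]
    linarith
  have hz2 : f - h = (f - h) 0 • qB q a 0 := by
    funext x
    induction x with
    | zero => simp [qB]
    | succ x ih =>
      rw [hz, ih]
      simp only [qB, Pi.smul_apply, smul_eq_mul, pow_zero, mul_one]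
      ring
  have : f = h + (f - h) 0 • qB q a 0 := by rw [← hz2]; abel
  rw [this]
  refine Submodule.add_mem _ h1 (Submodule.smul_mem _ _ (qB_mem q ?_))
  by_cases h0 : a = 0
  · right
    have := ha h0
    omega
  · exact Or.inl h0

lemma qrec_one {q : ℝ} (hq : 1 < q) (a m m' k : ℕ) (hm : m ≤ m') (ha : a = 0 → m + 1 ≤ m')
    (W : ℕ → ℕ → ℝ) (T : ℕ → ℕ → ℝ) (hT : T 0 k = q ^ a)
    (hW : ∀ x, W k (x + 1) = ∑ p ∈ antidiagonal k, T p.1 p.2 * W p.2 x)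
    (hlt : ∀ j < k, W j ∈ qS q m) : W k ∈ qS q m' := by
  apply qD_solve hq a m m' hm ha
  have : qD q a (W k) = ∑ p ∈ (antidiagonal k).erase (0, k), T p.1 p.2 • W p.2 := by
    funext x
    simp only [qD, LinearMap.coe_mk, AddHom.coe_mk, Finset.sum_apply, Pi.smul_apply, smul_eq_mul]
    rw [hW, ← Finset.add_sum_erase (antidiagonal k) _ (a := (0, k))
      (by simp), hT]
    ring
  rw [this]
  refine Submodule.sum_mem _ fun p hp => Submodule.smul_mem _ _ (hlt _ ?_)
  rw [Finset.mem_erase, Finset.HasAntidiagonal.mem_antidiagonal] at hp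
  obtain ⟨i, j⟩ := p
  simp only [ne_eq, Prod.mk.injEq] at hp ⊢
  omega

lemma qrec_all {q : ℝ} (hq : 1 < q) (m K : ℕ) (a : ℕ → ℕ)
    (W : ℕ → ℕ → ℝ) (T : ℕ → ℕ → ℕ → ℝ) (hT : ∀ k < K, T k 0 k = q ^ a k)
    (hW : ∀ k < K, ∀ x, W k (x + 1) = ∑ p ∈ antidiagonal k, T k p.1 p.2 * W p.2 x)
    (h0 : W 0 ∈ qS q m) (ha : ∀ k < K, k ≠ 0 → a k ≠ 0) : ∀ k < K, W k ∈ qS q m := by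
  intro k
  induction k using Nat.strong_induction_on with
  | _ k ih =>
    intro hk
    by_cases hk0 : k = 0
    · subst hk0; exact h0
    · exact qrec_one hq (a k) m m k le_rfl (fun h => absurd h (ha k hk hk0)) W (T k) (hT k hk)
        (hW k hk) (fun j hj => ih j hj (by omega))

lemma qS_expand {q : ℝ} {m : ℕ} {f : ℕ → ℝ} (hf : f ∈ qS q m) :
    ∃ d : (ℕ × ℕ) →₀ ℝ, (∀ x, f x = qQuasiEval q d x) ∧ ∀ b, m ≤ b → d (0, b) = 0 := by
  induction hf using Submodule.span_induction with
  | mem f h =>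
    obtain ⟨a, b, h1, rfl⟩ := h
    refine ⟨Finsupp.single (a, b) 1, fun x => ?_, fun b' hb' => ?_⟩
    · simp [qQuasiEval, qB]
    · rw [Finsupp.single_apply, if_neg]
      intro h
      simp only [Prod.mk.injEq] at h
      omega
  | zero => exact ⟨0, fun x => by simp [qQuasiEval], fun b _ => rfl⟩
  | add f g _ _ ihf ihg =>
    obtain ⟨d, h1, h2⟩ := ihf
    obtain ⟨e, h3, h4⟩ := ihg
    refine ⟨d + e, fun x => ?_, fun b hb => ?_⟩
    · rw [Pi.add_apply, h1, h3]
      unfold qQuasiEval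
      rw [Finsupp.sum_add_index' (by simp) (by intros; ring)]
    · rw [Finsupp.add_apply, h2 b hb, h4 b hb, add_zero]
  | smul c f _ ih =>
    obtain ⟨d, h1, h2⟩ := ih
    refine ⟨c • d, fun x => ?_, fun b hb => ?_⟩
    · rw [Pi.smul_apply, h1]
      unfold qQuasiEval
      rw [Finsupp.sum_smul_index' (by simp), smul_eq_mul, Finsupp.sum, Finsupp.sum, Finset.mul_sum]
      refine Finset.sum_congr rfl fun p _ => ?_
      simp only [smul_eq_mul]
      ring
    · rw [Finsupp.smul_apply, h2 b hb, smul_zero]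

open Filter Topology in
lemma qterm_tendsto {q : ℝ} (hq : 1 < q) (p p' : ℕ × ℕ) (h : toLex p < toLex p') :
    Tendsto (fun x : ℕ => q ^ (p.1 * x) * (x : ℝ) ^ p.2 / (q ^ (p'.1 * x) * (x : ℝ) ^ p'.2))
      atTop (𝓝 0) := by
  obtain ⟨a, b⟩ := p
  obtain ⟨a', b'⟩ := p'
  have h0 : (0 : ℝ) < q := by linarith
  rw [Prod.Lex.toLex_lt_toLex] at h
  rcases h with h | ⟨h, h'⟩
  · simp only at h ⊢
    have hr : |q⁻¹| < 1 := by
      rw [abs_of_pos (by positivity)]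
      exact inv_lt_one_of_one_lt₀ hq
    refine squeeze_zero' (Eventually.of_forall fun x => by positivity) ?_
      (tendsto_pow_const_mul_const_pow_of_abs_lt_one b hr)
    filter_upwards [eventually_ge_atTop 1] with x hx
    have hx1 : (1 : ℝ) ≤ x := by exact_mod_cast hx
    have h1 : (1 : ℝ) ≤ (x : ℝ) ^ b' := one_le_pow₀ hx1
    rw [div_le_iff₀ (by positivity)]
    have h2 : q ^ (a * x) * q ^ x ≤ q ^ (a' * x) := by
      rw [← pow_add]
      apply pow_le_pow_right₀ hq.le
      nlinarith
    have h3 : q ^ (a * x) ≤ q⁻¹ ^ x * q ^ (a' * x) := by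
      rw [inv_pow, inv_mul_eq_div, le_div_iff₀ (by positivity)]
      exact h2
    calc q ^ (a * x) * (x : ℝ) ^ b ≤ (q⁻¹ ^ x * q ^ (a' * x)) * (x : ℝ) ^ b := by gcongr
      _ = (x : ℝ) ^ b * q⁻¹ ^ x * (q ^ (a' * x) * 1) := by ring
      _ ≤ (x : ℝ) ^ b * q⁻¹ ^ x * (q ^ (a' * x) * (x : ℝ) ^ b') := by gcongr
  · simp only at h h' ⊢
    subst h
    refine squeeze_zero' (Eventually.of_forall fun x => by positivity) ?_
      tendsto_inv_atTop_nhds_zero_nat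
    filter_upwards [eventually_ge_atTop 1] with x hx
    have hx1 : (1 : ℝ) ≤ x := by exact_mod_cast hx
    have hx0 : (0 : ℝ) < x := by linarith
    rw [div_le_iff₀ (by positivity), inv_mul_eq_div, le_div_iff₀ hx0, mul_assoc, ← pow_succ]
    gcongr
    exact h'

open Filter Topology in
lemma qQuasi_zero {q : ℝ} (hq : 1 < q) (d : (ℕ × ℕ) →₀ ℝ) (N : ℕ)
    (h : ∀ x, N ≤ x → qQuasiEval q d x = 0) : d = 0 := by
  by_contra hd
  have hne : d.support.Nonempty := Finsupp.support_nonempty_iff.mpr hd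
  obtain ⟨p, hp, hmax⟩ := Finset.exists_max_image d.support toLex hne
  have h0 : (0 : ℝ) < q := by linarith
  have hlim : Tendsto (fun x : ℕ => ∑ s ∈ d.support,
      d s * (q ^ (s.1 * x) * (x : ℝ) ^ s.2 / (q ^ (p.1 * x) * (x : ℝ) ^ p.2))) atTop
      (𝓝 (∑ s ∈ d.support, if s = p then d s else 0)) := by
    apply tendsto_finsetSum
    intro s hs
    by_cases hsp : s = p
    · subst hsp
      rw [if_pos rfl]
      refine tendsto_const_nhds.congr' ?_
      filter_upwards [eventually_ge_atTop 1] with x hx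
      have hx0 : (0 : ℝ) < x := by exact_mod_cast hx
      rw [div_self (by positivity), mul_one]
    · rw [if_neg hsp]
      have hlt : toLex s < toLex p := lt_of_le_of_ne (hmax s hs) (fun e => hsp (toLex.injective e))
      simpa using (qterm_tendsto hq s p hlt).const_mul (d s)
  rw [Finset.sum_ite_eq' , if_pos hp] at hlim
  have hz : Tendsto (fun x : ℕ => ∑ s ∈ d.support,
      d s * (q ^ (s.1 * x) * (x : ℝ) ^ s.2 / (q ^ (p.1 * x) * (x : ℝ) ^ p.2))) atTop (𝓝 0) := by
    refine tendsto_const_nhds.congr' ?_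
    filter_upwards [eventually_ge_atTop N] with x hx
    have := h x hx
    unfold qQuasiEval Finsupp.sum at this
    rw [← zero_div (q ^ (p.1 * x) * (x : ℝ) ^ p.2), ← this, Finset.sum_div]
    refine Finset.sum_congr rfl fun s _ => ?_
    ring
  exact (Finsupp.mem_support_iff.mp hp) (tendsto_nhds_unique hlim hz)

/-- the germ functions attached to a triple -/
noncomputable def qW (q : ℝ) (n1 n2 n3 k x : ℕ) : ℝ :=
  q ^ (n3 * (n1 + n2) * x) * vol q k ((n1 : ℤ) + n2 - n3 - k) x

/-- the transfer coefficients of `qW` -/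
noncomputable def qT (q : ℝ) (n1 n2 n3 k m j : ℕ) : ℝ :=
  qG q m j * (q ^ (n3 * (n1 + n2)) * q ^ (((n1 : ℤ) + n2 - n3 - k) * j))

lemma qT_diag {q : ℝ} (hq : 1 < q) (n1 n2 n3 k : ℕ) (hk : k ≤ n2) :
    qT q n1 n2 n3 k 0 k = q ^ ((n3 + k) * (n1 + n2 - k)) := by
  have h0 : q ≠ 0 := by positivity
  unfold qT
  rw [qG_zero_left hq, one_mul, ← zpow_natCast, ← zpow_natCast, ← zpow_add₀ h0]
  congr 1
  push_cast [Nat.cast_sub (show k ≤ n1 + n2 by omega)]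
  ring

lemma qW_succ {q : ℝ} (hq : 1 < q) (n1 n2 n3 k x : ℕ) :
    qW q n1 n2 n3 k (x + 1) =
      ∑ p ∈ antidiagonal k, qT q n1 n2 n3 k p.1 p.2 * qW q n1 n2 n3 p.2 x := by
  unfold qW
  rw [vol_succ hq, Finset.mul_sum]
  refine Finset.sum_congr rfl fun p hp => ?_
  rw [Finset.HasAntidiagonal.mem_antidiagonal] at hp
  have e : (n1 : ℤ) + n2 - n3 - k + p.1 = (n1 : ℤ) + n2 - n3 - p.2 := by
    rw [← hp]; push_cast; ring
  rw [e]
  unfold qT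
  rw [mul_add (n3 * (n1 + n2)) x 1, mul_one, pow_add]
  ring

lemma qW_zero (q : ℝ) (n1 n2 n3 : ℕ) : qW q n1 n2 n3 0 = qB q (n3 * (n1 + n2)) 0 := by
  funext x
  simp [qW, qB, vol_zero_n]

lemma qW_mem {q : ℝ} (hq : 1 < q) (n1 n2 n3 : ℕ) (h : n1 + n3 ≠ 0) :
    qW q n1 n2 n3 n2 ∈ qS q 1 := by
  by_cases h1 : n1 = 0
  · by_cases h2 : n2 = 0
    · subst h2
      rw [qW_zero]
      exact qB_mem q (Or.inr one_pos)
    · have h0 : qW q n1 n2 n3 0 ∈ qS q 0 := by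
        rw [qW_zero]
        apply qB_mem
        left
        exact mul_ne_zero (by omega) (by omega)
      have hall := qrec_all hq 0 n2 (fun k => (n3 + k) * (n1 + n2 - k)) (qW q n1 n2 n3)
        (qT q n1 n2 n3) (fun k hk => qT_diag hq n1 n2 n3 k hk.le)
        (fun k _ x => qW_succ hq n1 n2 n3 k x) h0
        (fun k hk _ => mul_ne_zero (by omega) (by omega))
      exact qrec_one hq _ 0 1 n2 (by omega) (by omega) (qW q n1 n2 n3) (qT q n1 n2 n3 n2)
        (qT_diag hq n1 n2 n3 n2 le_rfl) (fun x => qW_succ hq n1 n2 n3 n2 x) hall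
  · have h0 : qW q n1 n2 n3 0 ∈ qS q 1 := by
      rw [qW_zero]
      exact qB_mem q (Or.inr one_pos)
    exact qrec_all hq 1 (n2 + 1) (fun k => (n3 + k) * (n1 + n2 - k)) (qW q n1 n2 n3)
      (qT q n1 n2 n3) (fun k hk => qT_diag hq n1 n2 n3 k (by omega))
      (fun k _ x => qW_succ hq n1 n2 n3 k x) h0
      (fun k hk _ => mul_ne_zero (by omega) (by omega)) n2 (by omega)

/-- generalized eigenvector for the eigenvalue `1` in the case `(0, n, 0)` -/
noncomputable def qE (q : ℝ) (n k x : ℕ) : ℝ :=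
  if k < n then qP q (n - 1 - k) / qP q (n - 1) else (n / qP q (n - 1)) * x

lemma qE_succ {q : ℝ} (hq : 1 < q) (n k x : ℕ) (hn : 1 ≤ n) (hk : k ≤ n) :
    qE q n k (x + 1) = ∑ p ∈ antidiagonal k, qT q 0 n 0 k p.1 p.2 * qE q n p.2 x := by
  have h0 : q ≠ 0 := by positivity
  rcases hk.lt_or_eq with hk | rfl
  · have e := qident1 hq (n - 1 - k) k
    unfold qE
    rw [if_pos hk, ← e, Finset.sum_div]
    refine Finset.sum_congr rfl fun p hp => ?_
    rw [Finset.HasAntidiagonal.mem_antidiagonal] at hp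
    rw [if_pos (by omega), show n - 1 - k + p.1 = n - 1 - p.2 by omega]
    unfold qT
    have : q ^ ((((0 : ℕ) : ℤ) + n - ((0 : ℕ) : ℤ) - k) * p.2) = q ^ ((n - 1 - k + 1) * p.2) := by
      rw [← zpow_natCast]
      congr 1
      push_cast [show n - 1 - k + 1 = n - k by omega, Nat.cast_sub hk.le]
      ring
    rw [this]
    simp
    ring
  · have e := qident2 hq k
    have hT : ∀ m j, qT q 0 k 0 k m j = qG q m j := by
      intro m j
      simp [qT]
    simp only [hT]
    have hs : ∀ p ∈ antidiagonal k, qG q p.1 p.2 * qE q k p.2 x =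
        qG q p.1 p.2 * (if p.1 = 0 then 0 else qP q (p.1 - 1)) / qP q (k - 1) +
        (if p = (0, k) then k / qP q (k - 1) * (x : ℝ) else 0) := by
      intro p hp
      obtain ⟨i, j⟩ := p
      rw [Finset.HasAntidiagonal.mem_antidiagonal] at hp
      simp only [Prod.mk.injEq] at hp ⊢
      unfold qE
      by_cases hi : i = 0
      · subst hi
        have : j = k := by omega
        subst this
        simp [qG_zero_left hq]
      · rw [if_pos (by omega), if_neg hi, if_neg (by omega), show k - 1 - j = i - 1 by omega]
        ring
    rw [Finset.sum_congr rfl hs, Finset.sum_add_distrib, ← Finset.sum_div, e,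
      Finset.sum_ite_eq', if_pos (by simp)]
    unfold qE
    rw [if_neg (lt_irrefl _)]
    push_cast
    ring

lemma qW_main {q : ℝ} (hq : 1 < q) (n : ℕ) (hn : 1 ≤ n) :
    (fun x => qW q 0 n 0 n x - n / qP q (n - 1) * x) ∈ qS q 1 := by
  set R : ℕ → ℕ → ℝ := fun k x => qW q 0 n 0 k x - qE q n k x with hR
  have hrec : ∀ k ≤ n, ∀ x, R k (x + 1) =
      ∑ p ∈ antidiagonal k, qT q 0 n 0 k p.1 p.2 * R p.2 x := by
    intro k hk x
    simp only [hR, mul_sub, Finset.sum_sub_distrib]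
    rw [qW_succ hq, qE_succ hq n k x hn hk]
  have h0 : R 0 ∈ qS q 0 := by
    have : R 0 = 0 := by
      funext x
      simp only [hR, qW_zero]
      simp [qB, qE, show 0 < n by omega, qP_ne hq]
    rw [this]
    exact Submodule.zero_mem _
  have hall := qrec_all hq 0 n (fun k => (0 + k) * (0 + n - k)) R
    (qT q 0 n 0) (fun k hk => qT_diag hq 0 n 0 k hk.le)
    (fun k hk x => hrec k hk.le x) h0
    (fun k hk hk0 => mul_ne_zero (by omega) (by omega))
  have := qrec_one hq _ 0 1 n (by omega) (by omega) R (qT q 0 n 0 n)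
    (qT_diag hq 0 n 0 n le_rfl) (fun x => hrec n le_rfl x) hall
  simpa [hR, qE] using this

lemma Bn_eq (q : ℝ) (n : ℕ) (hn : 1 ≤ n) : Bn q n = n / qP q (n - 1) := by
  unfold Bn qP
  rw [Finset.prod_inv_distrib, Finset.prod_Ico_eq_prod_range, div_eq_mul_inv]
  simp only [add_comm 1]

lemma germ_mem {q : ℝ} (hq : 1 < q) (n : ℕ) (hn : 1 ≤ n) (c : ℕ × ℕ × ℕ → ℝ) :
    (fun x : ℕ => germComb q n c x - c (0, n, 0) * Bn q n * x) ∈ qS q 1 := by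
  have hmem : ((0, n, 0) : ℕ × ℕ × ℕ) ∈ triples n := by simp [triples]
  have hterm : ∀ (t : ℕ × ℕ × ℕ) (x : ℕ), c t * q ^ (t.2.2 * (t.1 + t.2.1) * x) *
      vol q t.2.1 ((t.1 : ℤ) - (t.2.2 : ℤ)) x = c t * qW q t.1 t.2.1 t.2.2 t.2.1 x := by
    intro t x
    unfold qW
    rw [show (t.1 : ℤ) + t.2.1 - t.2.2 - t.2.1 = (t.1 : ℤ) - t.2.2 by ring]
    ring
  have heq : (fun x : ℕ => germComb q n c x - c (0, n, 0) * Bn q n * x) =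
      c (0, n, 0) • (fun x : ℕ => qW q 0 n 0 n x - n / qP q (n - 1) * x) +
      ∑ t ∈ (triples n).erase (0, n, 0), c t • qW q t.1 t.2.1 t.2.2 t.2.1 := by
    funext x
    simp only [Pi.add_apply, Finset.sum_apply, Pi.smul_apply, smul_eq_mul]
    unfold germComb
    simp only [hterm]
    rw [← Finset.add_sum_erase _ _ hmem, Bn_eq q n hn]
    ring
  rw [heq]
  refine Submodule.add_mem _ (Submodule.smul_mem _ _ (qW_main hq n hn))
    (Submodule.sum_mem _ fun t ht => Submodule.smul_mem _ _ (qW_mem hq _ _ _ ?_))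
  obtain ⟨a, b, e⟩ := t
  simp only [triples, Finset.mem_erase, ne_eq, Prod.mk.injEq, Finset.mem_filter] at ht ⊢
  omega

/-- **Isolating the linear term of the germ expansion.** Fix `q > 1` and `n ≥ 1`; for
constants `c_{(n₁,n₂,n₃)}` indexed by triples of nonnegative integers with sum `n`, set
`F(x) := Σ c_{(n₁,n₂,n₃)} q^{n₃(n₁+n₂)x} vol_{n₂,n₁−n₃}(x)`. Then `F` admits a
`q`-quasi-polynomial expansion with coefficients `d` such that `d(0,1) = c_{(0,n,0)} · B_n`,
where `B_n` is nonzero; in particular, if `F(x) = 0` for all sufficiently large integers `x`,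
then `c_{(0,n,0)} = 0`. -/
theorem germComb_linear_coeff (q : ℝ) (hq : 1 < q) (n : ℕ) (hn : 1 ≤ n)
    (c : ℕ × ℕ × ℕ → ℝ) :
    (∃ d : (ℕ × ℕ) →₀ ℝ,
        (∀ x : ℕ, 1 ≤ x → germComb q n c x = qQuasiEval q d x) ∧
        d (0, 1) = c (0, n, 0) * Bn q n) ∧
    Bn q n ≠ 0 ∧
    ((∃ N : ℕ, ∀ x : ℕ, N ≤ x → germComb q n c x = 0) → c (0, n, 0) = 0) := by
  have hB : Bn q n ≠ 0 := by
    rw [Bn_eq q n hn]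
    have h1 := qP_ne hq (n - 1)
    have h2 : (n : ℝ) ≠ 0 := by
      have : n ≠ 0 := by omega
      exact_mod_cast this
    exact div_ne_zero h2 h1
  obtain ⟨d, hd, hd0⟩ := qS_expand (germ_mem hq n hn c)
  set e : (ℕ × ℕ) →₀ ℝ := d + Finsupp.single (0, 1) (c (0, n, 0) * Bn q n) with he
  have he1 : ∀ x : ℕ, germComb q n c x = qQuasiEval q e x := by
    intro x
    have h1 := hd x
    have h2 : qQuasiEval q e x = qQuasiEval q d x + c (0, n, 0) * Bn q n * x := by
      unfold qQuasiEval
      rw [he, Finsupp.sum_add_index' (by simp) (by intros; ring), Finsupp.sum_single_index (by simp)]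
      simp
    rw [h2, ← h1]
    ring
  have he2 : e (0, 1) = c (0, n, 0) * Bn q n := by
    rw [he, Finsupp.add_apply, hd0 1 le_rfl, Finsupp.single_eq_same, zero_add]
  refine ⟨⟨e, fun x _ => he1 x, he2⟩, hB, ?_⟩
  rintro ⟨N, hN⟩
  have hz := qQuasi_zero hq e N (fun x hx => by rw [← he1]; exact hN x hx)
  rw [hz, Finsupp.zero_apply] at he2
  exact (mul_eq_zero.mp he2.symm).resolve_right hB
end

section
/- Let F be a finite field with q elements and let m, n ≥ 0 be integers. Then q^{n·m} = Σ_{β=0}^{n} N_β · ∏_{i=0}^{β−1} (q^{m} − q^{i}), where N_β denotes the number of β-dimensional F-linear subspaces of F^n. Equivalently, the number of F-linear maps from F^n to F^m equals the sum over 0 ≤ β ≤ n of the number of β-dimensional subspaces of F^n times ∏_{i=0}^{β−1} (q^{m} − q^{i}). -/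
/-- Rows are independent iff the map is onto. -/
theorem rows_aux (F : Type*) [Field F] (m b : ℕ) (A : Matrix (Fin b) (Fin m) F) :
    LinearIndependent F A.row ↔ LinearMap.range (Matrix.toLin' A) = ⊤ := by
  rw [linearIndependent_iff_card_eq_finrank_span, Set.finrank, ← Matrix.rank_eq_finrank_span_row,
    Matrix.rank, ← Matrix.toLin'_apply', Fintype.card_fin]
  constructor
  · intro h
    apply Submodule.eq_top_of_finrank_eq
    rw [← h]; simp
  · intro h
    rw [h]; simp

/-- Number of linear maps onto `F^b`. -/
theorem card_surj_aux (F : Type*) [Field F] [Fintype F] (m b : ℕ) :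
    (Nat.card {g : (Fin m → F) →ₗ[F] (Fin b → F) // LinearMap.range g = ⊤} : ℤ) =
      ∏ i ∈ Finset.range b, ((Fintype.card F : ℤ) ^ m - (Fintype.card F : ℤ) ^ i) := by
  classical
  have e : {g : (Fin m → F) →ₗ[F] (Fin b → F) // LinearMap.range g = ⊤} ≃
      {s : Fin b → (Fin m → F) // LinearIndependent F s} := by
    refine Equiv.symm (Equiv.subtypeEquiv (Matrix.toLin' (R := F) (m := Fin b) (n := Fin m)).toEquiv ?_)
    intro s
    exact rows_aux F m b (Matrix.of s)
  rw [Nat.card_congr e]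
  by_cases hb : b ≤ m
  · rw [card_linearIndependent (by simpa using hb), Finset.prod_range, Nat.cast_prod]
    refine Finset.prod_congr rfl fun i _ => ?_
    rw [Nat.cast_sub]
    · simp
    · apply Nat.pow_le_pow_right Fintype.card_pos
      simp; omega
  · rw [Finset.prod_eq_zero (i := m) (by simp; omega) (by simp)]
    have : IsEmpty {s : Fin b → (Fin m → F) // LinearIndependent F s} := by
      refine ⟨fun s => hb ?_⟩
      simpa using s.2.fintype_card_le_finrank
    simp

/-- Number of linear maps with range `W`. -/
theorem card_range_aux (F : Type*) [Field F] [Fintype F] (m n : ℕ)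
    (W : Submodule F (Fin n → F)) :
    (Nat.card {f : (Fin m → F) →ₗ[F] (Fin n → F) // LinearMap.range f = W} : ℤ) =
      ∏ i ∈ Finset.range (Module.finrank F W),
        ((Fintype.card F : ℤ) ^ m - (Fintype.card F : ℤ) ^ i) := by
  rw [← card_surj_aux]
  congr 1
  let c : W ≃ₗ[F] (Fin (Module.finrank F W) → F) := (Module.finBasis F W).equivFun
  symm
  refine Nat.card_congr (Equiv.ofBijective
    (fun g => ⟨W.subtype ∘ₗ c.symm.toLinearMap ∘ₗ g.1, ?_⟩) ⟨?_, ?_⟩)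
  · rw [LinearMap.range_comp, LinearMap.range_comp, g.2]
    simp
  · intro g h hgh
    ext1
    have := LinearMap.congr_fun (Subtype.ext_iff.mp hgh) 
    refine LinearMap.ext fun x => c.symm.injective (Subtype.ext ?_)
    exact this x
  · rintro ⟨f, hf⟩
    have hm : ∀ x, f x ∈ W := fun x => hf ▸ LinearMap.mem_range_self f x
    refine ⟨⟨c.toLinearMap ∘ₗ f.codRestrict W hm, ?_⟩, ?_⟩
    · rw [LinearMap.range_comp, LinearMap.range_codRestrict, hf]
      simp
    · ext1
      refine LinearMap.ext fun x => ?_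
      simp

theorem main_aux (F : Type*) [Field F] [Fintype F] (m n : ℕ) :
    (Nat.card ((Fin m → F) →ₗ[F] (Fin n → F)) : ℤ) =
      ∑ β ∈ Finset.range (n + 1),
        (Nat.card {W : Submodule F (Fin n → F) // Module.finrank F W = β} : ℤ) *
          ∏ i ∈ Finset.range β, ((Fintype.card F : ℤ) ^ m - (Fintype.card F : ℤ) ^ i) := by
  classical
  have : Finite ((Fin m → F) →ₗ[F] (Fin n → F)) := Finite.of_injective _ DFunLike.coe_injective
  have : Finite (Submodule F (Fin n → F)) := Finite.of_injective _ SetLike.coe_injective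
  have := Fintype.ofFinite (Submodule F (Fin n → F))
  rw [← Nat.card_congr (Equiv.sigmaFiberEquiv
    (fun f : (Fin m → F) →ₗ[F] (Fin n → F) => LinearMap.range f)), Nat.card_sigma, Nat.cast_sum]
  simp_rw [card_range_aux]
  rw [← Finset.sum_fiberwise_of_maps_to (s := Finset.univ) (t := Finset.range (n + 1))
    (g := fun W : Submodule F (Fin n → F) => Module.finrank F W)]
  · refine Finset.sum_congr rfl fun b _ => ?_
    rw [Finset.sum_congr rfl (g := fun _ => ∏ i ∈ Finset.range b,
      ((Fintype.card F : ℤ) ^ m - (Fintype.card F : ℤ) ^ i))]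
    · rw [Finset.sum_const, nsmul_eq_mul, Nat.card_eq_fintype_card, Fintype.card_subtype]
    · intro W hW
      rw [(Finset.mem_filter.mp hW).2]
  · intro W _
    have := Submodule.finrank_le W
    simp at this ⊢
    omega

theorem card_hom_aux (F : Type*) [Field F] [Fintype F] (m n : ℕ) :
    Nat.card ((Fin m → F) →ₗ[F] (Fin n → F)) = Fintype.card F ^ (n * m) := by
  classical
  rw [← Nat.card_congr (Matrix.toLin' (R := F) (m := Fin n) (n := Fin m)).toEquiv, Matrix]
  simp [Nat.card_eq_fintype_card, ← pow_mul, mul_comm]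

/-- **Counting linear maps via subspaces.** Let `F` be a finite field with `q` elements and
`m, n ≥ 0`. Then `q^{n·m} = Σ_{β=0}^{n} N_β · ∏_{i=0}^{β−1} (q^{m} − q^{i})` (in `ℤ`),
where `N_β` is the number of `β`-dimensional `F`-subspaces of `F^n`. Equivalently, the number
of `F`-linear maps `F^n → F^m` equals the sum over `0 ≤ β ≤ n` of the number of
`β`-dimensional subspaces of `F^n` times `∏_{i=0}^{β−1} (q^{m} − q^{i})`. -/
theorem card_linear_maps_eq_sum_over_subspaces
    (F : Type*) [Field F] [Fintype F] (m n : ℕ) :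
    ((Fintype.card F : ℤ) ^ (n * m) =
      ∑ β ∈ Finset.range (n + 1),
        (Nat.card {W : Submodule F (Fin n → F) // Module.finrank F W = β} : ℤ) *
          ∏ i ∈ Finset.range β, ((Fintype.card F : ℤ) ^ m - (Fintype.card F : ℤ) ^ i)) ∧
    ((Nat.card ((Fin n → F) →ₗ[F] (Fin m → F)) : ℤ) =
      ∑ β ∈ Finset.range (n + 1),
        (Nat.card {W : Submodule F (Fin n → F) // Module.finrank F W = β} : ℤ) *
          ∏ i ∈ Finset.range β, ((Fintype.card F : ℤ) ^ m - (Fintype.card F : ℤ) ^ i)) := by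

  rw [← main_aux, card_hom_aux, card_hom_aux, mul_comm m n]
  simp
end
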